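/- Let (h_0 = 1, h_1, …, h_e) be a pure O-sequence with e ≥ 3. Then h_1 ≤ h_2, and for every index i with 2 ≤ i ≤ e one has (as integers) h_i − h_{i−1} ≤ ((h_2 − h_1)_(2))^{i−2}_{i−2}. -/

import Mathlib

/-- The degree of a monomial, given by its exponent vector. -/
def monDeg {r : ℕ} (M : Fin r → ℕ) : ℕ := ∑ j, M j

/-- `X` is a (monomial) order ideal: a nonempty finite set of monomials (exponent vectors)
closed under divisibility. -/
def IsOrderIdeal {r : ℕ} (X : Finset (Fin r → ℕ)) : Prop :=
  X.Nonempty ∧ ∀ M ∈ X, ∀ N : Fin r → ℕ, (∀ j, N j ≤ M j) → N ∈ X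

/-- `M` is a maximal monomial of `X` with respect to divisibility. -/
def IsMaxMon {r : ℕ} (X : Finset (Fin r → ℕ)) (M : Fin r → ℕ) : Prop :=
  M ∈ X ∧ ∀ N ∈ X, (∀ j, M j ≤ N j) → N = M

/-- `X` is a pure order ideal with socle degree `e`: it is an order ideal whose maximal
degree is `e` and all of whose maximal monomials have degree `e`. -/
def IsPureWithSocle {r : ℕ} (X : Finset (Fin r → ℕ)) (e : ℕ) : Prop :=
  IsOrderIdeal X ∧ (∀ M ∈ X, monDeg M ≤ e) ∧ (∃ M ∈ X, monDeg M = e) ∧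
    ∀ M, IsMaxMon X M → monDeg M = e

/-- `h` agrees in degrees `≤ e` with the h-vector of `X`. -/
def HasHVector {r : ℕ} (X : Finset (Fin r → ℕ)) (h : ℕ → ℕ) (e : ℕ) : Prop :=
  ∀ i ≤ e, h i = (X.filter fun M => monDeg M = i).card

/-- `h` is (in degrees `≤ e`) a pure O-sequence of socle degree `e`. -/
def IsPureOSeq (h : ℕ → ℕ) (e : ℕ) : Prop :=
  ∃ (r : ℕ) (X : Finset (Fin r → ℕ)), IsPureWithSocle X e ∧ HasHVector X h e

/-- `h` is a pure O-sequence of socle degree `e` and type `t`. -/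
def IsPureOSeqOfType (h : ℕ → ℕ) (e t : ℕ) : Prop :=
  ∃ (r : ℕ) (X : Finset (Fin r → ℕ)), IsPureWithSocle X e ∧ HasHVector X h e ∧
    {M : Fin r → ℕ | IsMaxMon X M}.ncard = t

/-- `((n)_(d))_1^1`, computed from the `d`-binomial (Macaulay) expansion of `n`
obtained greedily; by convention `((0)_(d))_1^1 = 0`. -/
def macaulayBound : ℕ → ℕ → ℕ
  | 0, _ => 0
  | (n+1), d =>
      Nat.choose (Nat.findGreatest (fun k => Nat.choose k d ≤ n + 1) (n + 1 + d) + 1) (d + 1) +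
        macaulayBound
          ((n + 1) - Nat.choose (Nat.findGreatest (fun k => Nat.choose k d ≤ n + 1) (n + 1 + d)) d)
          (d - 1)
  termination_by n d => n
  decreasing_by
    have hd : d ≤ Nat.findGreatest (fun k => Nat.choose k d ≤ n + 1) (n + 1 + d) :=
      Nat.le_findGreatest (by omega) (by simp [Nat.choose_self])
    have hpos := Nat.choose_pos hd
    omega

/-- `g` satisfies Macaulay's bound (in degrees `1 ≤ i ≤ e - 1`). -/
def SatisfiesMacaulay (g : ℕ → ℕ) (e : ℕ) : Prop :=
  ∀ i, 1 ≤ i → i + 1 ≤ e → g (i + 1) ≤ macaulayBound (g i) i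

/-- `h` is an O-sequence of socle degree `e`. -/
def IsOSeq (h : ℕ → ℕ) (e : ℕ) : Prop :=
  h 0 = 1 ∧ (∀ i ≤ e, 0 < h i) ∧ SatisfiesMacaulay h e

/-- `h` is differentiable: its first difference `(1, h 1 - h 0, …, h e - h (e-1))`
consists of nonnegative integers and satisfies Macaulay's bound. -/
def IsDifferentiable (h : ℕ → ℕ) (e : ℕ) : Prop :=
  h 0 = 1 ∧ (∀ i, 1 ≤ i → i ≤ e → h (i - 1) ≤ h i) ∧
    SatisfiesMacaulay (fun i => if i = 0 then 1 else h i - h (i - 1)) e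

/-- `((m)_(2))^j_j`, obtained from the 2-binomial expansion
`m = C(k₂,2) + C(k₁,1)` (or `m = C(k₂,2)`) by `C(k₂+j, 2+j) + C(k₁+j, 1+j)`
(respectively `C(k₂+j, 2+j)`); by convention `((0)_(2))^j_j = 0`. -/
def shiftBound2 (m j : ℕ) : ℕ :=
  if m = 0 then 0 else
    Nat.choose (Nat.findGreatest (fun k => Nat.choose k 2 ≤ m) (m + 2) + j) (2 + j) +
      Nat.choose
        ((m - Nat.choose (Nat.findGreatest (fun k => Nat.choose k 2 ≤ m) (m + 2)) 2) + j)
        (1 + j)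


lemma choose_conv (j a t s : ℕ) (h : t ≤ a) :
    (a + j).choose (1 + j) + (t + s + j).choose (1 + j) ≤
      (a + s + j).choose (1 + j) + (t + j).choose (1 + j) := by
  induction s with
  | zero => simp
  | succ s ih =>
    have e1 : ∀ x : ℕ, (x + 1 + j).choose (1 + j) = (x + j).choose j + (x + j).choose (1 + j) := by
      intro x
      rw [show x + 1 + j = (x + j) + 1 by ring, show 1 + j = j + 1 by ring, Nat.choose_succ_succ]
    have h2 := e1 (t + s)
    have h3 := e1 (a + s)
    have h4 : (t + s + j).choose j ≤ (a + s + j).choose j := Nat.choose_le_choose _ (by omega)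
    rw [← add_assoc, ← add_assoc, h2, h3]
    omega

lemma choose_two_succ (k : ℕ) : (k + 1).choose 2 = k.choose 2 + k := by
  rw [Nat.choose_succ_succ' k 1]; simp; omega

lemma shift_eq_lt (k t j : ℕ) (hk : 1 ≤ k) (ht : t < k) :
    shiftBound2 (k.choose 2 + t) j = (k + j).choose (2 + j) + (t + j).choose (1 + j) := by
  unfold shiftBound2
  by_cases h0 : k.choose 2 + t = 0
  · have h1 : k = 1 := by
      have : k.choose 2 = 0 := by omega
      rw [Nat.choose_eq_zero_iff] at this; omega
    have h2 : t = 0 := by omega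
    subst h1 h2
    rw [if_pos h0, Nat.choose_eq_zero_of_lt (by omega), Nat.choose_eq_zero_of_lt (by omega)]
  · rw [if_neg h0]
    have hf : Nat.findGreatest (fun k' => Nat.choose k' 2 ≤ k.choose 2 + t)
        (k.choose 2 + t + 2) = k := by
      rw [Nat.findGreatest_eq_iff]
      refine ⟨?_, fun _ => by omega, ?_⟩
      · obtain ⟨q, rfl⟩ := Nat.exists_eq_add_of_le' hk
        have := choose_two_succ q
        omega
      · intro n hn _
        have h1 : (k + 1).choose 2 ≤ n.choose 2 := Nat.choose_le_choose _ hn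
        have := choose_two_succ k
        omega
    rw [hf]; simp

lemma shift_eq (k t j : ℕ) (hk : 1 ≤ k) (ht : t ≤ k) :
    shiftBound2 (k.choose 2 + t) j = (k + j).choose (2 + j) + (t + j).choose (1 + j) := by
  rcases ht.lt_or_eq with h | rfl
  · exact shift_eq_lt k t j hk h
  · have := shift_eq_lt (t + 1) 0 j (by omega) (by omega)
    rw [← choose_two_succ]
    rw [add_zero] at this
    rw [this, Nat.choose_eq_zero_of_lt (by omega : 0 + j < 1 + j),
      show t + 1 + j = (t + j) + 1 by ring, show 2 + j = (1 + j) + 1 by ring,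
      Nat.choose_succ_succ]
    ring

lemma exists_rep (m : ℕ) : ∃ k t, 1 ≤ k ∧ t < k ∧ m = k.choose 2 + t := by
  induction m with
  | zero => exact ⟨1, 0, by simp⟩
  | succ m ih =>
    obtain ⟨k, t, hk, ht, rfl⟩ := ih
    by_cases h : t + 1 < k
    · exact ⟨k, t + 1, hk, h, by ring⟩
    · refine ⟨k + 1, 0, by omega, by omega, ?_⟩
      rw [choose_two_succ]; omega

lemma shift_step (k t j d : ℕ) (hk : 1 ≤ k) (ht : t < k) (hd : 1 ≤ d) (hdk : d < k) :
    shiftBound2 (k.choose 2 + t - d) j + (d + j).choose (1 + j) ≤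
      shiftBound2 (k.choose 2 + t) j := by
  rw [shift_eq k t j hk ht.le]
  by_cases h : d ≤ t
  · rw [show k.choose 2 + t - d = k.choose 2 + (t - d) by omega, shift_eq k (t - d) j hk (by omega)]
    have := choose_conv j d 0 (t - d) (by omega)
    rw [Nat.choose_eq_zero_of_lt (by omega : 0 + j < 1 + j), zero_add,
      show d + (t - d) = t by omega] at this
    omega
  · obtain ⟨q, rfl⟩ := Nat.exists_eq_add_of_le' hk
    have h2 := choose_two_succ q
    rw [show (q + 1).choose 2 + t - d = q.choose 2 + (q + t - d) by omega,
      shift_eq q (q + t - d) j (by omega) (by omega)]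
    have := choose_conv j d t (q - d) (by omega)
    rw [show d + (q - d) = q by omega, show t + (q - d) = q + t - d by omega] at this
    have h3 : (q + 1 + j).choose (2 + j) = (q + j).choose (1 + j) + (q + j).choose (2 + j) := by
      rw [show q + 1 + j = (q + j) + 1 by ring, show 2 + j = (1 + j) + 1 by ring,
        Nat.choose_succ_succ]
    omega

section comb
variable {r : ℕ}

/-- The exponent vector of a variable. -/
abbrev ev (v : Fin r) : Fin r → ℕ := Pi.single v 1

lemma ev_le_iff (v : Fin r) (M : Fin r → ℕ) : ev v ≤ M ↔ 1 ≤ M v := by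
  constructor
  · intro h; simpa using h v
  · intro h w
    by_cases hw : w = v
    · subst hw; simpa using h
    · simp [ev, hw]

lemma monDeg_add (M N : Fin r → ℕ) : monDeg (M + N) = monDeg M + monDeg N := by
  simp [monDeg, Finset.sum_add_distrib]

lemma monDeg_ev (v : Fin r) : monDeg (ev v) = 1 := by
  simp [monDeg, ev]

lemma exists_ev_le (M : Fin r → ℕ) (h : 1 ≤ monDeg M) : ∃ v N, M = ev v + N := by
  by_contra hc
  push Not at hc
  have : monDeg M = 0 := by
    unfold monDeg
    apply Finset.sum_eq_zero
    intro v _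
    by_contra hv
    have h1 : ev v ≤ M := (ev_le_iff v M).2 (by omega)
    obtain ⟨N, hN⟩ := exists_add_of_le h1
    exact hc v N hN
  omega

/-- Neighbours of `v` in the graph (with loops) on the variables given by `E`. -/
def nbr (E : Finset (Fin r → ℕ)) (v : Fin r) : Finset (Fin r) :=
  Finset.univ.filter fun w => ev v + ev w ∈ E

lemma mem_nbr {E : Finset (Fin r → ℕ)} {v w : Fin r} : w ∈ nbr E v ↔ ev v + ev w ∈ E := by
  simp [nbr]

/-- Edges between `v` and a set of variables. -/
def edg (v : Fin r) (A : Finset (Fin r)) : Finset (Fin r → ℕ) := A.image fun w => ev v + ev w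

lemma card_edg (v : Fin r) (A : Finset (Fin r)) : (edg v A).card = A.card := by
  apply Finset.card_image_of_injective
  intro a b hab
  have : ev a = ev b := add_left_cancel hab
  by_contra hne
  have h1 := congrFun this a
  simp [ev, hne] at h1

lemma touch_bound (E : Finset (Fin r → ℕ)) (k : ℕ) (W : Finset (Fin r))
    (hW : ∀ v ∈ W, k ≤ (nbr E v).card) (hWk : W.card ≤ k) :
    (k + 1).choose 2 ≤ (E.filter fun N => ∃ v ∈ W, 1 ≤ N v).card + (k - W.card + 1).choose 2 := by
  induction W using Finset.induction_on with
  | empty => simp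
  | insert v W hv ih =>
    rw [Finset.card_insert_of_notMem hv] at hWk ⊢
    have ih := ih (fun u hu => hW u (Finset.mem_insert_of_mem hu)) (by omega)
    have hd := hW v (Finset.mem_insert_self _ _)
    have hsub : (E.filter fun N => ∃ u ∈ W, 1 ≤ N u) ∪ edg v (nbr E v \ W) ⊆
        E.filter fun N => ∃ u ∈ insert v W, 1 ≤ N u := by
      intro N hN
      rcases Finset.mem_union.1 hN with hN | hN
      · obtain ⟨h1, u, hu, h2⟩ := Finset.mem_filter.1 hN
        exact Finset.mem_filter.2 ⟨h1, u, Finset.mem_insert_of_mem hu, h2⟩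
      · obtain ⟨w, hw, rfl⟩ := Finset.mem_image.1 hN
        refine Finset.mem_filter.2 ⟨mem_nbr.1 (Finset.mem_sdiff.1 hw).1, v,
          Finset.mem_insert_self _ _, by simp [ev]⟩
    have hdis : Disjoint (E.filter fun N => ∃ u ∈ W, 1 ≤ N u) (edg v (nbr E v \ W)) := by
      rw [Finset.disjoint_left]
      intro N hN hN2
      obtain ⟨h1, u, hu, h2⟩ := Finset.mem_filter.1 hN
      obtain ⟨w, hw, rfl⟩ := Finset.mem_image.1 hN2
      have huv : u ≠ v := fun h => hv (h ▸ hu)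
      have huw : u ≠ w := fun h => (Finset.mem_sdiff.1 hw).2 (h ▸ hu)
      simp [ev, huv, huw] at h2
    have h1 := Finset.card_le_card hsub
    rw [Finset.card_union_of_disjoint hdis, card_edg] at h1
    have h2 := Finset.le_card_sdiff W (nbr E v)
    have h3 := choose_two_succ (k - W.card)
    rw [show k - (W.card + 1) + 1 = k - W.card by omega]
    omega

lemma exists_small (E : Finset (Fin r → ℕ)) (k : ℕ) (hE : E.card < (k + 1).choose 2)
    (v₀ : Fin r) (h₀ : (nbr E v₀).Nonempty) :
    ∃ v, 1 ≤ (nbr E v).card ∧ (nbr E v).card < k := by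
  by_contra hc
  push Not at hc
  have h1 := hc v₀ h₀.card_pos
  obtain ⟨W, hW, hWk⟩ := Finset.exists_subset_card_eq h1
  have := touch_bound E k W (fun v hv => hc v (Finset.card_pos.2 ⟨v₀, by
    rw [mem_nbr, add_comm]; exact mem_nbr.1 (hW hv)⟩)) hWk.le
  have h2 := Finset.card_filter_le E fun N => ∃ v ∈ W, 1 ≤ N v
  rw [hWk] at this
  simp at this
  omega

lemma comb_bound (j : ℕ) (m : ℕ) : ∀ (E S : Finset (Fin r → ℕ)), E.card = m →
    (∀ M ∈ S, monDeg M = j + 2) → (∀ M ∈ S, ∀ a b, ev a + ev b ≤ M → ev a + ev b ∈ E) →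
    S.card ≤ shiftBound2 m j := by
  induction m using Nat.strong_induction_on with
  | _ m ih =>
  intro E S hm hdeg hS
  rcases S.eq_empty_or_nonempty with rfl | ⟨M₀, hM₀⟩
  · simp
  obtain ⟨a, N, hN⟩ := exists_ev_le M₀ (by rw [hdeg _ hM₀]; omega)
  obtain ⟨b, N', hN'⟩ := exists_ev_le N (by
    have := hdeg _ hM₀; rw [hN, monDeg_add, monDeg_ev] at this; omega)
  have hab : ev a + ev b ∈ E := hS _ hM₀ a b (by
    rw [hN, hN', ← add_assoc]; exact le_self_add)
  obtain ⟨k, t, hk, ht, hmk⟩ := exists_rep m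
  obtain ⟨v, hv1, hvk⟩ := exists_small E k (by rw [choose_two_succ]; omega) a ⟨b, mem_nbr.2 hab⟩
  set d := (nbr E v).card with hd
  have hsubE : edg v (nbr E v) ⊆ E := by
    intro N hN
    obtain ⟨w, hw, rfl⟩ := Finset.mem_image.1 hN
    exact mem_nbr.1 hw
  have hdE : d ≤ m := by
    have := Finset.card_le_card hsubE
    rw [card_edg] at this; omega
  have hA := ih (m - d) (by omega) (E \ edg v (nbr E v)) (S.filter fun M => M v = 0)
    (by rw [Finset.card_sdiff_of_subset hsubE, card_edg, hm])
    (fun M hM => hdeg M (Finset.mem_filter.1 hM).1)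
    (by
      intro M hM a b hab
      obtain ⟨hM1, hM2⟩ := Finset.mem_filter.1 hM
      refine Finset.mem_sdiff.2 ⟨hS M hM1 a b hab, fun hc => ?_⟩
      obtain ⟨w, hw, hweq⟩ := Finset.mem_image.1 hc
      rw [← hweq] at hab
      have := hab v
      rw [hM2] at this
      simp [ev] at this)
  have hB : (S.filter fun M => ¬ M v = 0).card ≤ (d + j).choose (1 + j) := by
    have : (Finset.piAntidiag (nbr E v) (j + 1)).card = (d + j).choose (1 + j) := by
      have h1 := Finset.card_finsuppAntidiag_nat_eq_choose (s := nbr E v) (j + 1)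
      rw [Finset.finsuppAntidiag, Finset.card_map, Finset.card_attach] at h1
      rw [h1, show j + 1 = 1 + j by ring]
      congr 1
      omega
    rw [← this]
    apply Finset.card_le_card_of_injOn (fun M => M - ev v)
    · intro M hM
      obtain ⟨hM1, hM2⟩ := Finset.mem_filter.1 (Finset.mem_coe.1 hM)
      obtain ⟨N, rfl⟩ := exists_add_of_le ((ev_le_iff v M).2 (by omega))
      have hsupp : ∀ w, N w ≠ 0 → w ∈ nbr E v := by
        intro w hw
        apply mem_nbr.2
        apply hS _ hM1
        gcongr
        exact (ev_le_iff w N).2 (by omega)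
      have h1 := hdeg _ hM1
      rw [monDeg_add, monDeg_ev] at h1
      simp only [add_tsub_cancel_left, Finset.mem_coe, Finset.mem_piAntidiag]
      refine ⟨?_, hsupp⟩
      rw [Finset.sum_subset (Finset.subset_univ _)]
      · unfold monDeg at h1; omega
      · intro w _ hw
        by_contra h
        exact hw (hsupp w h)
    · intro M hM M' hM' heq
      obtain ⟨_, h2⟩ := Finset.mem_filter.1 (Finset.mem_coe.1 hM)
      obtain ⟨_, h2'⟩ := Finset.mem_filter.1 (Finset.mem_coe.1 hM')
      obtain ⟨N, rfl⟩ := exists_add_of_le ((ev_le_iff v M).2 (by omega))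
      obtain ⟨N', rfl⟩ := exists_add_of_le ((ev_le_iff v M').2 (by omega))
      simp only [add_tsub_cancel_left] at heq
      rw [heq]
  have hstep := shift_step k t j d hk ht hv1 hvk
  rw [← hmk] at hstep
  have := Finset.card_filter_add_card_filter_not (s := S) (fun M => M v = 0)
  omega

end comb

section lin
open scoped Classical

/-- Positions of minimal support of elements of `K`. -/
noncomputable def lead {α β : Type*} [LinearOrder β] (o : α → β) (S : Finset α)
    (K : Submodule ℚ (α → ℚ)) : Finset α :=
  S.filter fun a => ∃ φ ∈ K, φ a ≠ 0 ∧ ∀ b, o b < o a → φ b = 0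

lemma lead_card {α β : Type*} [LinearOrder β] (o : α → β) (ho : Function.Injective o)
    (S : Finset α) (K : Submodule ℚ (α → ℚ)) (hK : ∀ φ ∈ K, ∀ a, φ a ≠ 0 → a ∈ S) :
    Module.Finite ℚ K ∧ (lead o S K).card = Module.finrank ℚ K := by
  classical
  let R : K →ₗ[ℚ] (lead o S K → ℚ) :=
    { toFun := fun φ a => φ.1 a.1
      map_add' := fun _ _ => rfl
      map_smul' := fun _ _ => rfl }
  have hR : Function.Injective R := by
    rw [injective_iff_map_eq_zero]
    intro φ hφ
    by_contra hne
    have hex : (S.filter fun a => φ.1 a ≠ 0).Nonempty := by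
      by_contra hc
      rw [Finset.not_nonempty_iff_eq_empty] at hc
      apply hne
      ext a
      by_contra ha
      have : a ∈ S.filter fun a => φ.1 a ≠ 0 := Finset.mem_filter.2 ⟨hK _ φ.2 a ha, ha⟩
      rw [hc] at this
      simp at this
    obtain ⟨a, ha, hmin⟩ := Finset.exists_min_image _ o hex
    obtain ⟨haS, ha0⟩ := Finset.mem_filter.1 ha
    have hal : a ∈ lead o S K := by
      refine Finset.mem_filter.2 ⟨haS, φ.1, φ.2, ha0, fun b hb => ?_⟩
      by_contra hb0
      exact absurd (hmin b (Finset.mem_filter.2 ⟨hK _ φ.2 b hb0, hb0⟩)) (not_le.2 hb)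
    exact ha0 (congrFun hφ ⟨a, hal⟩)
  have hfin : Module.Finite ℚ K := Module.Finite.of_injective R hR
  refine ⟨hfin, le_antisymm ?_ ?_⟩
  · have hch : ∀ a : lead o S K, ∃ φ : K, φ.1 a.1 ≠ 0 ∧ ∀ b, o b < o a.1 → φ.1 b = 0 := by
      intro a
      obtain ⟨_, φ, h1, h2⟩ := Finset.mem_filter.1 a.2
      exact ⟨⟨φ, h1⟩, h2⟩
    choose f hf0 hf using hch
    have hli : LinearIndependent ℚ f := by
      rw [Fintype.linearIndependent_iff]
      intro g hg
      by_contra hc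
      push Not at hc
      obtain ⟨i, hi⟩ := hc
      obtain ⟨a, ha, hmin⟩ := Finset.exists_min_image
        (Finset.univ.filter fun a => g a ≠ 0) (fun a => o a.1) ⟨i, by simpa using hi⟩
      have ha0 : g a ≠ 0 := by simpa using ha
      have h1 := congrFun (congrArg Subtype.val hg) a.1
      simp only [Submodule.coe_sum, Submodule.coe_smul, Finset.sum_apply, Pi.smul_apply,
        smul_eq_mul, ZeroMemClass.coe_zero, Pi.zero_apply] at h1
      rw [Finset.sum_eq_single a] at h1
      · exact (mul_ne_zero ha0 (hf0 a)) h1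
      · intro b _ hba
        by_cases hb : g b = 0
        · simp [hb]
        · have hle := hmin b (by simpa using hb)
          have hlt : o a.1 < o b.1 := lt_of_le_of_ne hle fun h => hba (Subtype.ext (ho h)).symm
          rw [hf b _ hlt, mul_zero]
      · simp
    have := hli.fintype_card_le_finrank
    simpa using this
  · have := LinearMap.finrank_le_finrank_of_injective hR
    simpa using this

variable {r : ℕ}

/-- Sum of the shifts: dual of multiplication by the sum of the variables. -/
def DD (r : ℕ) : ((Fin r → ℕ) → ℚ) →ₗ[ℚ] ((Fin r → ℕ) → ℚ) where
  toFun φ := fun N => ∑ j, φ (N + ev j)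
  map_add' φ ψ := by ext N; simp [Finset.sum_add_distrib]
  map_smul' c φ := by ext N; simp [Finset.mul_sum]

/-- Degree `i` part of `X`. -/
def Xd (X : Finset (Fin r → ℕ)) (i : ℕ) : Finset (Fin r → ℕ) := X.filter fun M => monDeg M = i

/-- Functions supported on `S`. -/
def VV (S : Finset (Fin r → ℕ)) : Submodule ℚ ((Fin r → ℕ) → ℚ) where
  carrier := {φ | ∀ a, φ a ≠ 0 → a ∈ S}
  add_mem' := by
    intro φ ψ h1 h2 a ha
    by_contra hc
    have e1 : φ a = 0 := by by_contra h; exact hc (h1 a h)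
    have e2 : ψ a = 0 := by by_contra h; exact hc (h2 a h)
    exact ha (by simp [e1, e2])
  zero_mem' := by intro a ha; exact absurd rfl ha
  smul_mem' := by
    intro c φ h a ha
    apply h a
    intro h0
    exact ha (by simp [h0])

lemma mem_VV {S : Finset (Fin r → ℕ)} {φ : (Fin r → ℕ) → ℚ} :
    φ ∈ VV S ↔ ∀ a, φ a ≠ 0 → a ∈ S := Iff.rfl

lemma single_mem_VV {S : Finset (Fin r → ℕ)} {a : Fin r → ℕ} (ha : a ∈ S) :
    (Pi.single a 1 : (Fin r → ℕ) → ℚ) ∈ VV S := by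
  intro b hb
  by_cases h : b = a
  · exact h ▸ ha
  · simp [h] at hb

lemma VV_finrank (S : Finset (Fin r → ℕ)) :
    Module.Finite ℚ (VV S) ∧ Module.finrank ℚ (VV S) = S.card := by
  obtain ⟨h1, h2⟩ := lead_card (toLex : (Fin r → ℕ) → Lex (Fin r → ℕ)) toLex.injective S (VV S)
    (fun φ hφ => hφ)
  refine ⟨h1, ?_⟩
  rw [← h2]
  congr 1
  refine Finset.Subset.antisymm (Finset.filter_subset _ _) ?_
  intro a ha
  refine Finset.mem_filter.2 ⟨ha, Pi.single a 1, single_mem_VV ha, by simp, ?_⟩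
  intro b hb
  have : b ≠ a := by rintro rfl; exact lt_irrefl _ hb
  simp [this]

/-- The dual of `A/LA` in degree `i`. -/
def KK (X : Finset (Fin r → ℕ)) (i : ℕ) : Submodule ℚ ((Fin r → ℕ) → ℚ) :=
  (LinearMap.ker ((DD r).domRestrict (VV (Xd X i)))).map (VV (Xd X i)).subtype

lemma mem_KK {X : Finset (Fin r → ℕ)} {i : ℕ} {φ : (Fin r → ℕ) → ℚ} :
    φ ∈ KK X i ↔ φ ∈ VV (Xd X i) ∧ DD r φ = 0 := by
  simp only [KK, Submodule.mem_map, LinearMap.mem_ker]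
  constructor
  · rintro ⟨ψ, h, rfl⟩
    exact ⟨ψ.2, h⟩
  · rintro ⟨h1, h2⟩
    exact ⟨⟨φ, h1⟩, h2, rfl⟩

lemma finrank_KK (X : Finset (Fin r → ℕ)) (i : ℕ) :
    Module.finrank ℚ (LinearMap.range ((DD r).domRestrict (VV (Xd X i)))) +
      Module.finrank ℚ (KK X i) = (Xd X i).card := by
  have := (VV_finrank (Xd X i)).1
  rw [KK, Submodule.finrank_map_subtype_eq, LinearMap.finrank_range_add_finrank_ker,
    (VV_finrank _).2]

lemma range_le (X : Finset (Fin r → ℕ)) (hX : IsOrderIdeal X) (i : ℕ) :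
    LinearMap.range ((DD r).domRestrict (VV (Xd X (i + 1)))) ≤ VV (Xd X i) := by
  rintro _ ⟨⟨φ, hφ⟩, rfl⟩
  intro N hN
  change ∑ j, φ (N + ev j) ≠ 0 at hN
  obtain ⟨j, _, hj⟩ := Finset.exists_ne_zero_of_sum_ne_zero hN
  obtain ⟨h1, h2⟩ := Finset.mem_filter.1 (hφ _ hj)
  rw [monDeg_add, monDeg_ev] at h2
  exact Finset.mem_filter.2 ⟨hX.2 _ h1 N fun j => by simp, by omega⟩

/-- Leading monomials in degree `i`. -/
noncomputable def TT (X : Finset (Fin r → ℕ)) (i : ℕ) : Finset (Fin r → ℕ) :=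
  lead (toLex : (Fin r → ℕ) → Lex (Fin r → ℕ)) (Xd X i) (KK X i)

lemma card_TT (X : Finset (Fin r → ℕ)) (i : ℕ) :
    (TT X i).card = Module.finrank ℚ (KK X i) :=
  (lead_card _ toLex.injective _ _ fun _ hφ => (mem_KK.1 hφ).1).2

lemma TT_deg {X : Finset (Fin r → ℕ)} {i : ℕ} {M : Fin r → ℕ} (h : M ∈ TT X i) :
    monDeg M = i :=
  (Finset.mem_filter.1 (Finset.mem_filter.1 h).1).2

lemma TT_down (X : Finset (Fin r → ℕ)) (hX : IsOrderIdeal X) (i : ℕ) (v : Fin r) (N : Fin r → ℕ)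
    (h : N + ev v ∈ TT X (i + 1)) : N ∈ TT X i := by
  obtain ⟨h1, φ, hφ, h0, hlt⟩ := Finset.mem_filter.1 h
  obtain ⟨hV, hD⟩ := mem_KK.1 hφ
  have hV' : ∀ M, φ (M + ev v) ≠ 0 → M ∈ Xd X i := by
    intro M hM
    obtain ⟨h1, h2⟩ := Finset.mem_filter.1 (hV _ hM)
    rw [monDeg_add, monDeg_ev] at h2
    exact Finset.mem_filter.2 ⟨hX.2 _ h1 M fun j => by simp, by omega⟩
  refine Finset.mem_filter.2 ⟨hV' _ h0, fun M => φ (M + ev v), mem_KK.2 ⟨hV', ?_⟩, h0, ?_⟩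
  · ext M
    have := congrFun hD (M + ev v)
    simp only [DD, LinearMap.coe_mk, AddHom.coe_mk, Pi.zero_apply] at this ⊢
    rw [← this]
    refine Finset.sum_congr rfl fun j _ => ?_
    rw [add_right_comm]
  · intro b hb
    apply hlt
    rw [toLex_add, toLex_add]
    exact add_lt_add_left hb _

lemma TT_down' (X : Finset (Fin r → ℕ)) (hX : IsOrderIdeal X) (i : ℕ) (n : ℕ) :
    ∀ (N P : Fin r → ℕ), monDeg P = n → N + P ∈ TT X (i + n) → N ∈ TT X i := by
  induction n with
  | zero =>
    intro N P hP h
    have : P = 0 := by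
      by_contra hne
      obtain ⟨v, hv⟩ := Function.ne_iff.1 hne
      obtain ⟨Q, rfl⟩ := exists_add_of_le ((ev_le_iff v P).2 (Nat.one_le_iff_ne_zero.2 hv))
      rw [monDeg_add, monDeg_ev] at hP
      omega
    simpa [this] using h
  | succ n ih =>
    intro N P hP h
    obtain ⟨v, Q, rfl⟩ := exists_ev_le P (by omega)
    rw [monDeg_add, monDeg_ev] at hP
    apply ih N Q (by omega)
    apply TT_down X hX (i + n) v
    rw [show N + Q + ev v = N + (ev v + Q) by abel]
    exact h

lemma ev_inj {a b : Fin r} (h : ev a = ev b) : a = b := by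
  by_contra hne
  have h1 := congrFun h a
  simp [ev, hne] at h1

lemma add_ev_eq_iff (N : Fin r → ℕ) (j a b : Fin r) :
    N + ev j = ev a + ev b ↔ (j = a ∧ N = ev b) ∨ (j = b ∧ N = ev a) := by
  constructor
  · intro h
    have h1 := congrFun h j
    by_cases ha : j = a
    · subst ha
      left
      exact ⟨rfl, add_left_cancel ((add_comm _ _).trans h)⟩
    · by_cases hb : j = b
      · subst hb
        right
        exact ⟨rfl, add_right_cancel h⟩
      · simp [ev, ha, hb] at h1
  · rintro (⟨rfl, rfl⟩ | ⟨rfl, rfl⟩)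
    · exact add_comm _ _
    · rfl

lemma DD_single_add {a b : Fin r} (c : ℚ) (hab : a ≠ b) :
    DD r (Pi.single (ev a + ev b) c) = Pi.single (ev a) c + Pi.single (ev b) c := by
  ext N
  change ∑ j, (Pi.single (ev a + ev b) c : (Fin r → ℕ) → ℚ) (N + ev j) = _
  have hterm : ∀ j, (Pi.single (ev a + ev b) c : (Fin r → ℕ) → ℚ) (N + ev j) =
      (if j = b then (if N = ev a then c else 0) else 0) +
        (if j = a then (if N = ev b then c else 0) else 0) := by
    intro j
    simp only [Pi.single_apply, add_ev_eq_iff]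
    by_cases h1 : j = a
    · subst h1
      simp [hab]
    · simp [h1, ite_and]
  simp only [hterm, Finset.sum_add_distrib]
  simp [Pi.single_apply]

lemma DD_single_self (a : Fin r) (c : ℚ) :
    DD r (Pi.single (ev a + ev a) c) = Pi.single (ev a) c := by
  ext N
  change ∑ j, (Pi.single (ev a + ev a) c : (Fin r → ℕ) → ℚ) (N + ev j) = _
  have hterm : ∀ j, (Pi.single (ev a + ev a) c : (Fin r → ℕ) → ℚ) (N + ev j) =
      (if j = a then (if N = ev a then c else 0) else 0) := by
    intro j
    simp only [Pi.single_apply, add_ev_eq_iff, or_self, ite_and]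
  simp only [hterm]
  simp [Pi.single_apply]

lemma VV_le {S : Finset (Fin r → ℕ)} {P : Submodule ℚ ((Fin r → ℕ) → ℚ)}
    (h : ∀ a ∈ S, (Pi.single a 1 : (Fin r → ℕ) → ℚ) ∈ P) : VV S ≤ P := by
  intro φ hφ
  have : φ = ∑ a ∈ S, φ a • (Pi.single a 1 : (Fin r → ℕ) → ℚ) := by
    ext b
    simp only [Finset.sum_apply, Pi.smul_apply, smul_eq_mul]
    by_cases hb : b ∈ S
    · rw [Finset.sum_eq_single b]
      · simp
      · intro c _ hc; simp [hc.symm]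
      · exact fun h => absurd hb h
    · have : φ b = 0 := by by_contra h; exact hb (hφ b h)
      rw [this]
      symm
      apply Finset.sum_eq_zero
      intro c hc
      have : b ≠ c := by rintro rfl; exact hb hc
      simp [this]
  rw [this]
  exact Submodule.sum_mem _ fun a ha => Submodule.smul_mem _ _ (h a ha)

lemma exists_top (X : Finset (Fin r → ℕ)) (e : ℕ) (hX : IsPureWithSocle X e) (N : Fin r → ℕ)
    (hN : N ∈ X) : ∃ P, N + P ∈ X ∧ monDeg (N + P) = e := by
  obtain ⟨M, hM, hmax⟩ := Finset.exists_max_image (X.filter fun M => N ≤ M) monDeg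
    ⟨N, Finset.mem_filter.2 ⟨hN, le_rfl⟩⟩
  obtain ⟨hMX, hNM⟩ := Finset.mem_filter.1 hM
  obtain ⟨P, rfl⟩ := exists_add_of_le hNM
  refine ⟨P, hMX, hX.2.2.2 _ ⟨hMX, fun Q hQ hle => ?_⟩⟩
  have hle' : N + P ≤ Q := hle
  have h1 := hmax Q (Finset.mem_filter.2 ⟨hQ, hNM.trans hle'⟩)
  obtain ⟨R, rfl⟩ := exists_add_of_le hle'
  by_contra hne
  have hR : 1 ≤ monDeg R := by
    by_contra hc
    have : R = 0 := by
      ext v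
      have : R v ≤ monDeg R := Finset.single_le_sum (fun _ _ => Nat.zero_le _) (Finset.mem_univ v)
      simp; omega
    exact hne (by simp [this])
  rw [monDeg_add (N + P)] at h1
  omega

lemma range_two (X : Finset (Fin r → ℕ)) (e : ℕ) (he : 3 ≤ e) (hX : IsPureWithSocle X e) :
    LinearMap.range ((DD r).domRestrict (VV (Xd X 2))) = VV (Xd X 1) := by
  apply le_antisymm (range_le X hX.1 1)
  apply VV_le
  intro N hN
  obtain ⟨hNX, hNd⟩ := Finset.mem_filter.1 hN
  have hmem : ∀ a b : Fin r, ev a + ev b ∈ X → ∀ c : ℚ,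
      DD r (Pi.single (ev a + ev b) 1) ∈ LinearMap.range ((DD r).domRestrict (VV (Xd X 2))) := by
    intro a b hab c
    refine ⟨⟨Pi.single (ev a + ev b) 1, single_mem_VV (Finset.mem_filter.2 ⟨hab, ?_⟩)⟩, rfl⟩
    rw [monDeg_add, monDeg_ev, monDeg_ev]
  obtain ⟨P, hPX, hPd⟩ := exists_top X e hX N hNX
  rw [monDeg_add, hNd] at hPd
  obtain ⟨a, Q, rfl⟩ := exists_ev_le N (by omega)
  have hQ : Q = 0 := by
    rw [monDeg_add, monDeg_ev] at hNd
    ext v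
    have : Q v ≤ monDeg Q := Finset.single_le_sum (fun _ _ => Nat.zero_le _) (Finset.mem_univ v)
    simp; omega
  subst hQ
  rw [add_zero] at hPX ⊢
  obtain ⟨b, P, rfl⟩ := exists_ev_le P (by omega)
  rw [monDeg_add, monDeg_ev] at hPd
  obtain ⟨c, P, rfl⟩ := exists_ev_le P (by omega)
  have hdown : ∀ x y : Fin r, ∀ R, ev a + (ev b + (ev c + P)) = ev x + ev y + R →
      ev x + ev y ∈ X := by
    intro x y R hR
    apply hX.1.2 _ hPX
    intro j
    rw [hR]
    simp
  have hab := hmem a b (hdown a b (ev c + P) (by abel)) 1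
  have hac := hmem a c (hdown a c (ev b + P) (by abel)) 1
  have hbc := hmem b c (hdown b c (ev a + P) (by abel)) 1
  by_cases e1 : a = b
  · subst e1
    rwa [DD_single_self] at hab
  by_cases e2 : a = c
  · subst e2
    rwa [DD_single_self] at hac
  rw [DD_single_add _ e1] at hab
  by_cases e3 : b = c
  · subst e3
    rw [DD_single_self] at hbc
    simpa using Submodule.sub_mem _ hab hbc
  rw [DD_single_add _ e2] at hac
  rw [DD_single_add _ e3] at hbc
  have := Submodule.smul_mem _ (1/2 : ℚ) (Submodule.sub_mem _ (Submodule.add_mem _ hab hac) hbc)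
  convert this using 1
  ext M
  simp only [Pi.smul_apply, Pi.add_apply, Pi.sub_apply, smul_eq_mul]
  ring

end lin

theorem growth_bound_of_pure (h : ℕ → ℕ) (e : ℕ) (he : 3 ≤ e)
    (hpure : IsPureOSeq h e) :
    h 1 ≤ h 2 ∧
      ∀ i, 2 ≤ i → i ≤ e →
        (h i : ℤ) - (h (i - 1) : ℤ) ≤ (shiftBound2 (h 2 - h 1) (i - 2) : ℤ) := by
  obtain ⟨r, X, hX, hh⟩ := hpure
  have hc : ∀ i ≤ e, h i = (Xd X i).card := hh
  have h2 := finrank_KK X 2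
  rw [range_two X e he hX, (VV_finrank _).2, ← card_TT, ← hc 1 (by omega), ← hc 2 (by omega)] at h2
  refine ⟨by omega, ?_⟩
  intro i hi hie
  obtain ⟨j, rfl⟩ := Nat.exists_eq_add_of_le' hi
  have h3 := finrank_KK X (j + 2)
  have := (VV_finrank (Xd X (j + 1))).1
  change Module.finrank ℚ (LinearMap.range ((DD r).domRestrict (VV (Xd X (j + 1 + 1))))) + _ = _ at h3
  have h4 := Submodule.finrank_mono (range_le X hX.1 (j + 1))
  rw [(VV_finrank _).2, ← hc _ (by omega)] at h4
  rw [← card_TT, ← hc _ hie] at h3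
  have h5 := comb_bound j _ (TT X 2) (TT X (j + 2)) rfl
    (fun M hM => TT_deg hM)
    (by
      intro M hM a b hab
      obtain ⟨P, rfl⟩ := exists_add_of_le hab
      have hd := TT_deg hM
      rw [monDeg_add, monDeg_add, monDeg_ev, monDeg_ev] at hd
      apply TT_down' X hX.1 2 j _ P (by omega)
      rwa [add_comm 2 j])
  rw [show h 2 - h 1 = (TT X 2).card by omega]
  rw [Nat.add_sub_cancel, show j + 2 - 1 = j + 1 by omega]
  omega
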